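/- Let G be a finitely generated elementary amenable group that is not virtually nilpotent. Then there exists a normal subgroup H of G such that G/H is virtually polycyclic and at least one of the following holds: (1) G/H has exponential growth; (2) H is not finitely generated. -/

import Mathlib

section GrowthDefs

variable {G : Type*} [Group G]

/-- The ball of radius `n` w.r.t. a finite set `X`: all elements of `G` that are products
of at most `n` letters from `X ∪ X⁻¹`. -/
def wordBall (X : Finset G) (n : ℕ) : Set G :=
  {g | ∃ l : List G, l.length ≤ n ∧ (∀ x ∈ l, x ∈ X ∨ x⁻¹ ∈ X) ∧ l.prod = g}

/-- The growth function `γ_G^X(n) = card {g ∈ G : ‖g‖_X ≤ n}`. -/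
noncomputable def growthFn (X : Finset G) (n : ℕ) : ℕ :=
  Nat.card (wordBall X n)

/-- The exponential growth rate `ω(G,X) = lim_{n→∞} γ_G^X(n)^{1/n}`, which by
submultiplicativity of the growth function equals `inf_{n ≥ 1} γ_G^X(n)^{1/n}`. -/
noncomputable def growthRateX (X : Finset G) : ℝ :=
  ⨅ n : ℕ, (growthFn X (n + 1) : ℝ) ^ ((1 : ℝ) / (n + 1))

/-- The minimal exponential growth rate `ω(G) = inf_X ω(G,X)`, the infimum being taken
over all finite generating sets `X` of `G`. -/
noncomputable def minGrowthRate (G : Type*) [Group G] : ℝ :=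
  sInf {r : ℝ | ∃ X : Finset G, Subgroup.closure (X : Set G) = ⊤ ∧ r = growthRateX X}

/-- `G` has exponential growth: `ω(G,X) > 1` for some (equivalently, every) finite
generating set `X`. -/
def HasExponentialGrowth (G : Type*) [Group G] : Prop :=
  ∃ X : Finset G, Subgroup.closure (X : Set G) = ⊤ ∧ 1 < growthRateX X

end GrowthDefs

universe u

/-- The class `EG` of elementary amenable groups: the smallest class of groups containing
all abelian groups and all finite groups and closed under taking subgroups, taking
quotient groups, group extensions and direct limits (directed unions). -/
inductive ElementaryAmenable : (G : Type u) → Group G → Prop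
  | abelian (G : Type u) [inst : Group G] (h : ∀ a b : G, a * b = b * a) :
      ElementaryAmenable G inst
  | finite (G : Type u) [inst : Group G] (h : Finite G) : ElementaryAmenable G inst
  | subgroup {G H : Type u} [instG : Group G] [instH : Group H] (f : H →* G)
      (hf : Function.Injective f) (hG : ElementaryAmenable G instG) :
      ElementaryAmenable H instH
  | quotient {G H : Type u} [instG : Group G] [instH : Group H] (f : G →* H)
      (hf : Function.Surjective f) (hG : ElementaryAmenable G instG) :
      ElementaryAmenable H instH
  | extension {G : Type u} [instG : Group G] (N : Subgroup G) [hN : N.Normal]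
      (h1 : ElementaryAmenable N inferInstance)
      (h2 : ElementaryAmenable (G ⧸ N) inferInstance) :
      ElementaryAmenable G instG
  | directedUnion {G : Type u} [instG : Group G] {ι : Type u} (K : ι → Subgroup G)
      (hdir : Directed (· ≤ ·) K) (htop : ⨆ i, K i = ⊤)
      (h : ∀ i, ElementaryAmenable (K i) inferInstance) :
      ElementaryAmenable G instG

/-- A group `G` is polycyclic if it admits a finite subnormal series
`1 = P_k ⊴ P_{k-1} ⊴ … ⊴ P_0 = G` with all quotients `P_{i-1}/P_i` cyclic: each term
is normal in the next one and the corresponding quotient is generated by the image of a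
single element `g`. -/
def IsPolycyclic (G : Type*) [Group G] : Prop :=
  ∃ (n : ℕ) (P : Fin (n + 1) → Subgroup G),
    P 0 = ⊥ ∧ P (Fin.last n) = ⊤ ∧
    ∀ i : Fin n,
      P i.castSucc ≤ P i.succ ∧
      (∀ x ∈ P i.succ, ∀ h ∈ P i.castSucc, x * h * x⁻¹ ∈ P i.castSucc) ∧
      (∃ g ∈ P i.succ, ∀ x ∈ P i.succ, ∃ k : ℤ, (g ^ k)⁻¹ * x ∈ P i.castSucc)

/-- A group is virtually polycyclic if it has a polycyclic subgroup of finite index. -/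
def IsVirtuallyPolycyclic (G : Type*) [Group G] : Prop :=
  ∃ H : Subgroup G, H.FiniteIndex ∧ IsPolycyclic H

/-- A group is virtually nilpotent if it has a nilpotent subgroup of finite index. -/
def IsVirtuallyNilpotent (G : Type*) [Group G] : Prop :=
  ∃ H : Subgroup G, H.FiniteIndex ∧ Group.IsNilpotent H

theorem Subgroup.FG.map_hom {G H : Type*} [Group G] [Group H] {K : Subgroup G} (hK : K.FG)
    (f : G →* H) : (K.map f).FG := by
  have : Group.FG K := (Group.fg_iff_subgroup_fg K).2 hK
  exact (Group.fg_iff_subgroup_fg _).1 (Group.fg_of_surjective (f.subgroupMap_surjective K))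

/-- The smallest class of groups containing the trivial groups and closed under extensions by
subgroups of groups in the class `C` and, if `loc` holds, under directed unions. -/
inductive GeneratedBy (C : (A : Type u) → Group A → Prop) (loc : Prop) :
    (G : Type u) → Group G → Prop
  | trivial (G : Type u) [inst : Group G] (h : Subsingleton G) : GeneratedBy C loc G inst
  | ext {G A : Type u} [instG : Group G] [instA : Group A] (f : G →* A) (hA : C A instA)
      (h : GeneratedBy C loc f.ker inferInstance) : GeneratedBy C loc G instG
  | directed {G : Type u} [instG : Group G] (hloc : loc)
      (h : ∀ K : Subgroup G, K.FG → GeneratedBy C loc K inferInstance) : GeneratedBy C loc G instG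

namespace GeneratedBy

variable {C : (A : Type u) → Group A → Prop} {loc : Prop}

theorem of_injective {G : Type u} {instG : Group G} (hG : GeneratedBy C loc G instG) :
    ∀ {H : Type u} [instH : Group H] (i : H →* G), Function.Injective i →
      GeneratedBy C loc H instH := by
  induction hG with
  | trivial G h => exact fun i hi => .trivial _ hi.subsingleton
  | @ext G A _ _ f hA _ ih =>
    intro H _ i hi
    refine .ext (f.comp i) hA (ih ((i.comp (f.comp i).ker.subtype).codRestrict _ ?_) ?_)
    · exact fun x => x.2
    · intro x y hxy
      exact Subtype.ext (hi (congrArg Subtype.val hxy))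
  | @directed G _ hloc _ ih =>
    intro H _ i hi
    refine .directed hloc fun K hK => ih (K.map i) (hK.map_hom i) (i.subgroupMap K) ?_
    intro x y hxy
    exact Subtype.ext (hi (congrArg Subtype.val hxy))

theorem of_mem {A : Type u} [instA : Group A] (hA : C A instA) : GeneratedBy C loc A instA :=
  .ext (MonoidHom.id A) hA (.trivial _ ⟨fun x y => Subtype.ext (x.2.trans y.2.symm)⟩)

theorem extension {Q : Type u} {instQ : Group Q} (hQ : GeneratedBy C loc Q instQ) :
    ∀ {G : Type u} [instG : Group G] (p : G →* Q),
      GeneratedBy C loc p.ker inferInstance → GeneratedBy C loc G instG := by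
  induction hQ with
  | trivial Q h =>
    intro G _ p hp
    refine hp.of_injective ((MonoidHom.id G).codRestrict _ fun x => Subsingleton.elim _ _) ?_
    exact fun x y hxy => congrArg Subtype.val hxy
  | @ext Q A _ _ f hA _ ih =>
    intro G _ p hp
    refine .ext (f.comp p) hA
      (ih ((p.comp (f.comp p).ker.subtype).codRestrict _ fun x => x.2) ?_)
    refine hp.of_injective (((f.comp p).ker.subtype.comp (Subgroup.subtype _)).codRestrict _ ?_) ?_
    · exact fun x => congrArg Subtype.val x.2
    · intro x y hxy
      have hxy' := congrArg Subtype.val hxy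
      exact Subtype.ext (Subtype.ext hxy')
  | @directed Q _ hloc _ ih =>
    intro G _ p hp
    refine .directed hloc fun K hK => ih (K.map p) (hK.map_hom p) (p.subgroupMap K) ?_
    refine hp.of_injective ((K.subtype.comp (Subgroup.subtype _)).codRestrict _ ?_) ?_
    · exact fun x => congrArg Subtype.val x.2
    · intro x y hxy
      have hxy' := congrArg Subtype.val hxy
      exact Subtype.ext (Subtype.ext hxy')

theorem of_surjective
    (hC : ∀ {A B : Type u} [instA : Group A] [instB : Group B] (f : A →* B),
      Function.Surjective f → C A instA → C B instB)
    (hC' : ∀ {A B : Type u} [instA : Group A] [instB : Group B] (f : A →* B),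
      Function.Injective f → C B instB → C A instA)
    {G : Type u} {instG : Group G} (hG : GeneratedBy C loc G instG) :
    ∀ {H : Type u} [instH : Group H] (p : G →* H), Function.Surjective p →
      GeneratedBy C loc H instH := by
  induction hG with
  | trivial G h => exact fun p hp => .trivial _ hp.subsingleton
  | @ext G A _ _ f hA _ ih =>
    intro H _ p hp
    let N : Subgroup H := f.ker.map p
    have : N.Normal := Subgroup.Normal.map inferInstance p hp
    let q : f.range →* H ⧸ N := (QuotientGroup.lift f.ker ((QuotientGroup.mk' N).comp p)
      (fun x hx => (QuotientGroup.eq_one_iff _).2 ⟨x, hx, rfl⟩)).comp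
        (QuotientGroup.quotientKerEquivRange f).symm.toMonoidHom
    have hq : Function.Surjective q := by
      intro y
      obtain ⟨y, rfl⟩ := QuotientGroup.mk_surjective y
      obtain ⟨x, rfl⟩ := hp y
      refine ⟨QuotientGroup.quotientKerEquivRange f (x : G ⧸ f.ker), ?_⟩
      simp only [q, MonoidHom.comp_apply, MulEquiv.coe_toMonoidHom, MulEquiv.symm_apply_apply]
      rfl
    refine .ext (QuotientGroup.mk' N)
      (hC q hq (hC' f.range.subtype Subtype.val_injective hA))
      (ih ((p.comp f.ker.subtype).codRestrict _ ?_) ?_)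
    · exact fun x => (QuotientGroup.eq_one_iff _).2 ⟨x, x.2, rfl⟩
    · rintro ⟨y, hy⟩
      obtain ⟨x, hx, rfl⟩ := (QuotientGroup.eq_one_iff _).1 hy
      exact ⟨⟨x, hx⟩, rfl⟩
  | @directed G _ hloc _ ih =>
    intro H _ p hp
    refine .directed hloc fun K hK => ?_
    obtain ⟨S, rfl⟩ := hK
    classical
    let T : Finset G := S.image (Function.surjInv hp)
    have hT : (Subgroup.closure (T : Set G)).map p = Subgroup.closure (S : Set H) := by
      rw [MonoidHom.map_closure]
      congr 1
      ext y
      simp [T, Function.surjInv_eq]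
    rw [← hT]
    exact ih _ ⟨T, rfl⟩ (p.subgroupMap _) (p.subgroupMap_surjective _)

end GeneratedBy

/-- The class of groups that are abelian or finite. -/
def IsAbelianOrFinite (A : Type u) (_ : Group A) : Prop := (∀ a b : A, a * b = b * a) ∨ Finite A

/-- The class of groups that are cyclic or finite. -/
def IsCyclicOrFinite (A : Type u) (_ : Group A) : Prop := IsCyclic A ∨ Finite A

/-- Poly-(cyclic or finite) groups. -/
abbrev PolyCyclicOrFinite (G : Type u) [inst : Group G] : Prop :=
  GeneratedBy IsCyclicOrFinite False G inst

theorem IsAbelianOrFinite.of_surjective {A B : Type u} [instA : Group A] [instB : Group B]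
    (f : A →* B) (hf : Function.Surjective f) :
    IsAbelianOrFinite A instA → IsAbelianOrFinite B instB := by
  rintro (h | h)
  · left
    intro a b
    obtain ⟨a, rfl⟩ := hf a
    obtain ⟨b, rfl⟩ := hf b
    rw [← map_mul, h, map_mul]
  · exact Or.inr (.of_surjective f hf)

theorem IsAbelianOrFinite.of_injective {A B : Type u} [instA : Group A] [instB : Group B]
    (f : A →* B) (hf : Function.Injective f) :
    IsAbelianOrFinite B instB → IsAbelianOrFinite A instA := by
  rintro (h | h)
  · exact Or.inl fun a b => hf (by rw [map_mul, h, map_mul])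
  · exact Or.inr (.of_injective f hf)

theorem ElementaryAmenable.generatedBy {G : Type u} {inst : Group G}
    (hG : ElementaryAmenable G inst) : GeneratedBy IsAbelianOrFinite True G inst := by
  induction hG with
  | abelian G h => exact .of_mem (Or.inl h)
  | finite G h => exact .of_mem (Or.inr h)
  | subgroup f hf _ ih => exact ih.of_injective f hf
  | quotient f hf _ ih =>
    exact ih.of_surjective IsAbelianOrFinite.of_surjective IsAbelianOrFinite.of_injective f hf
  | extension N _ _ ih1 ih2 =>
    refine ih2.extension (QuotientGroup.mk' N) (ih1.of_injective
      (Subgroup.inclusion (QuotientGroup.ker_mk' N).le) (Subgroup.inclusion_injective _))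
  | @directedUnion G _ ι K hdir htop _ ih =>
    rcases isEmpty_or_nonempty ι with h | h
    · rw [iSup_of_empty] at htop
      exact .trivial _ (Subgroup.subsingleton_iff.1 (subsingleton_of_bot_eq_top htop))
    refine .directed True.intro fun L hL => ?_
    obtain ⟨S, rfl⟩ := hL
    have key : ∀ S : Finset G, ∃ i, (S : Set G) ⊆ K i := by
      intro S
      classical
      induction S using Finset.induction_on with
      | empty => exact ⟨Classical.arbitrary ι, by simp⟩
      | insert a S _ hS =>
        obtain ⟨i, hi⟩ := hS
        obtain ⟨j, hj⟩ := (Subgroup.mem_iSup_of_directed hdir).1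
          (htop ▸ Subgroup.mem_top a : a ∈ ⨆ i, K i)
        obtain ⟨k, hik, hjk⟩ := hdir i j
        refine ⟨k, ?_⟩
        rw [Finset.coe_insert, Set.insert_subset_iff]
        exact ⟨hjk hj, hi.trans hik⟩
    obtain ⟨i, hi⟩ := key S
    exact (ih i).of_injective (Subgroup.inclusion ((Subgroup.closure_le _).2 hi))
      (Subgroup.inclusion_injective _)

instance MonoidHom.finite_of_fg {N A : Type*} [Group N] [Group A] [hN : Group.FG N] [Finite A] :
    Finite (N →* A) := by
  obtain ⟨S, hS⟩ := hN.out
  refine .of_injective (fun (f : N →* A) (s : S) => f s) fun f g hfg => ?_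
  refine MonoidHom.eq_of_eqOn_dense hS fun s hs => ?_
  exact congrFun hfg ⟨s, hs⟩

/-- The intersection of the kernels of all homomorphisms from `N` to `A`. -/
def commonKer (N A : Type*) [Group N] [Group A] : Subgroup N := ⨅ h : N →* A, h.ker

theorem mem_commonKer {N A : Type*} [Group N] [Group A] {x : N} :
    x ∈ commonKer N A ↔ ∀ h : N →* A, h x = 1 := by
  simp [commonKer, Subgroup.mem_iInf, MonoidHom.mem_ker]

instance commonKer_characteristic (N A : Type*) [Group N] [Group A] :
    (commonKer N A).Characteristic := by
  rw [Subgroup.characteristic_iff_le_comap]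
  intro φ x hx
  exact mem_commonKer.2 fun h => mem_commonKer.1 hx (h.comp φ.toMonoidHom)

instance commonKer_finiteIndex (N A : Type*) [Group N] [Group A] [Group.FG N] [Finite A] :
    (commonKer N A).FiniteIndex :=
  Subgroup.finiteIndex_iInf fun _ => inferInstance

theorem PolyCyclicOrFinite.of_fg_of_comm {A : Type u} [instA : Group A] [hA : Group.FG A]
    (hcomm : ∀ a b : A, a * b = b * a) : PolyCyclicOrFinite A := by
  classical
  have key : ∀ S : Finset A, PolyCyclicOrFinite (Subgroup.closure (S : Set A)) := by
    intro S
    induction S using Finset.induction_on with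
    | empty =>
      refine .trivial _ ?_
      rw [Finset.coe_empty, Subgroup.closure_empty]
      infer_instance
    | insert a S _ hS =>
      let N := Subgroup.closure (S : Set A)
      have : N.Normal := ⟨fun n hn g => by rwa [hcomm g n, mul_inv_cancel_right]⟩
      let K := Subgroup.closure ((insert a S : Finset A) : Set A)
      have hK : K ≤ (Subgroup.zpowers (a : A ⧸ N)).comap (QuotientGroup.mk' N) := by
        rw [Subgroup.closure_le, Finset.coe_insert, Set.insert_subset_iff]
        refine ⟨Subgroup.mem_zpowers _, fun s hs => ?_⟩
        have : (s : A ⧸ N) = 1 := (QuotientGroup.eq_one_iff _).2 (Subgroup.subset_closure hs)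
        simp [this]
      refine .ext (A := Subgroup.zpowers (a : A ⧸ N))
        (((QuotientGroup.mk' N).comp K.subtype).codRestrict _ fun x => hK x.2)
        (Or.inl inferInstance) (hS.of_injective ((K.subtype.comp (Subgroup.subtype _)).codRestrict _
          fun x => (QuotientGroup.eq_one_iff _).1 (congrArg Subtype.val x.2)) ?_)
      intro x y hxy
      have hxy' := congrArg Subtype.val hxy
      exact Subtype.ext (Subtype.ext hxy')
  obtain ⟨S, hS⟩ := hA.out
  exact (key S).of_injective ((MonoidHom.id A).codRestrict _ fun x => hS ▸ Subgroup.mem_top x)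
    fun x y hxy => congrArg Subtype.val hxy

theorem PolyCyclicOrFinite.of_finite {A : Type u} [instA : Group A] [hA : Finite A] :
    PolyCyclicOrFinite A := .of_mem (Or.inr hA)

theorem polyCyclicOrFinite_quotient_commonKer {N A : Type u} [Group N] [instA : Group A]
    [Group.FG N] (hA : IsAbelianOrFinite A instA) : PolyCyclicOrFinite (N ⧸ commonKer N A) := by
  rcases hA with h | h
  · refine .of_fg_of_comm fun x y => ?_
    obtain ⟨x, rfl⟩ := QuotientGroup.mk_surjective x
    obtain ⟨y, rfl⟩ := QuotientGroup.mk_surjective y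
    rw [← QuotientGroup.mk_mul, ← QuotientGroup.mk_mul, QuotientGroup.eq]
    exact mem_commonKer.2 fun f => by
      rw [map_mul, map_inv, map_mul, map_mul, h (f x), inv_mul_cancel]
  · exact .of_finite

/-- Let `N` be a finitely generated normal subgroup of `Γ` with poly-(cyclic or finite) quotient.
If `N` is in the closure of the class of abelian or finite groups, then either `Γ` is
poly-(cyclic or finite) or it has such a quotient with a kernel that is not finitely generated. -/
theorem GeneratedBy.polyCyclicOrFinite_or_exists_not_fg {G : Type u} {inst : Group G}
    (hG : GeneratedBy IsAbelianOrFinite True G inst) :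
    ∀ {Γ : Type u} [Group Γ] (N : Subgroup Γ) [N.Normal] (i : N →* G), Function.Injective i →
      N.FG → PolyCyclicOrFinite (Γ ⧸ N) →
      PolyCyclicOrFinite Γ ∨
        ∃ (H : Subgroup Γ) (_ : H.Normal), PolyCyclicOrFinite (Γ ⧸ H) ∧ ¬ H.FG := by
  induction hG with
  | trivial G h =>
    intro Γ _ N _ i hi _ hN
    refine Or.inl (hN.of_injective (QuotientGroup.mk' N) ?_)
    rw [← MonoidHom.ker_eq_bot_iff, QuotientGroup.ker_mk']
    have := hi.subsingleton
    exact N.eq_bot_of_subsingleton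
  | @ext G A _ _ f hA _ ih =>
    intro Γ _ N _ i hi hfg hN
    have : Group.FG N := (Group.fg_iff_subgroup_fg N).2 hfg
    let M : Subgroup Γ := (commonKer N A).map N.subtype
    have hMN : M ≤ N := Subgroup.map_subtype_le _
    have hM : PolyCyclicOrFinite (Γ ⧸ M) := by
      let p : Γ ⧸ M →* Γ ⧸ N := QuotientGroup.map M N (MonoidHom.id Γ) hMN
      refine hN.extension p ?_
      have hker : ∀ x : N, (x : Γ ⧸ M) ∈ p.ker := fun x =>
        (QuotientGroup.eq_one_iff (x : Γ)).2 x.2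
      let q : N →* p.ker := ((QuotientGroup.mk' M).comp N.subtype).codRestrict p.ker hker
      have hq : Function.Surjective q := by
        rintro ⟨x, hx⟩
        obtain ⟨x, rfl⟩ := QuotientGroup.mk_surjective x
        exact ⟨⟨x, (QuotientGroup.eq_one_iff x).1 hx⟩, rfl⟩
      have hqker : q.ker = commonKer N A := by
        ext x
        rw [MonoidHom.mem_ker, Subtype.ext_iff]
        refine (QuotientGroup.eq_one_iff (x : Γ)).trans ?_
        simp [M]
      refine (polyCyclicOrFinite_quotient_commonKer (N := N) hA).of_injective
        ((QuotientGroup.quotientKerEquivOfSurjective q hq).symm.trans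
          (QuotientGroup.quotientMulEquivOfEq hqker)).toMonoidHom (MulEquiv.injective _)
    by_cases hMfg : M.FG
    · have hMf : ∀ x : M, f (i (Subgroup.inclusion hMN x)) = 1 := by
        rintro ⟨_, x, hx, rfl⟩
        exact mem_commonKer.1 hx (f.comp i)
      refine ih M ((i.comp (Subgroup.inclusion hMN)).codRestrict _ hMf) ?_ hMfg hM
      intro x y hxy
      exact Subgroup.inclusion_injective hMN (hi (congrArg Subtype.val hxy))
    · exact Or.inr ⟨M, inferInstance, hM, hMfg⟩
  | @directed G _ _ _ ih =>
    intro Γ _ N _ i hi hfg hN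
    have : Group.FG N := (Group.fg_iff_subgroup_fg N).2 hfg
    exact ih i.range ((Group.fg_iff_subgroup_fg _).1 inferInstance) N i.rangeRestrict
      (MonoidHom.rangeRestrict_injective_iff.2 hi) hfg hN

/-- `G` contains two elements such that distinct words of the same length in them represent
distinct elements of `G`. -/
def HasFreePair (G : Type*) [Group G] : Prop :=
  ∃ a b : G, ∀ l l' : List Bool, l.length = l'.length →
    (l.map fun x => cond x a b).prod = (l'.map fun x => cond x a b).prod → l = l'

theorem HasFreePair.map {G H : Type*} [Group G] [Group H] (f : G →* H)
    (hf : Function.Injective f) (h : HasFreePair G) : HasFreePair H := by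
  obtain ⟨a, b, hab⟩ := h
  refine ⟨f a, f b, fun l l' hl hprod => hab l l' hl (hf ?_)⟩
  simpa only [map_list_prod, List.map_map, Function.comp_def, Bool.apply_cond f] using hprod

theorem HasFreePair.of_surjective {G H : Type*} [Group G] [Group H] (f : G →* H)
    (hf : Function.Surjective f) (h : HasFreePair H) : HasFreePair G := by
  obtain ⟨a, b, hab⟩ := h
  obtain ⟨a, rfl⟩ := hf a
  obtain ⟨b, rfl⟩ := hf b
  refine ⟨a, b, fun l l' hl hprod => hab l l' hl ?_⟩
  simpa only [map_list_prod, List.map_map, Function.comp_def, Bool.apply_cond f] using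
    congrArg f hprod

theorem wordBall_finite {G : Type*} [Group G] (X : Finset G) (n : ℕ) : (wordBall X n).Finite := by
  have hS : Finite ((X : Set G) ∪ (X : Set G)⁻¹ : Set G) :=
    (X.finite_toSet.union X.finite_toSet.inv).to_subtype
  refine ((List.finite_length_le ((X : Set G) ∪ (X : Set G)⁻¹ : Set G) n).image
    fun l => (l.map Subtype.val).prod).subset ?_
  rintro g ⟨l, hl, hlX, rfl⟩
  refine ⟨l.attach.map fun x => ⟨x.1, hlX x.1 x.2⟩, by simpa using hl, ?_⟩
  simp

theorem HasFreePair.hasExponentialGrowth {G : Type*} [Group G] (hfg : Group.FG G)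
    (h : HasFreePair G) : HasExponentialGrowth G := by
  classical
  obtain ⟨S, hS⟩ := hfg.out
  obtain ⟨a, b, hab⟩ := h
  let X : Finset G := {a, b} ∪ S
  refine ⟨X, ?_, ?_⟩
  · rw [eq_top_iff, ← hS]
    exact Subgroup.closure_mono (by rw [Finset.coe_union]; exact Set.subset_union_right)
  have hcard : ∀ n, 2 ^ n ≤ growthFn X n := by
    intro n
    have := (wordBall_finite X n).to_subtype
    let φ : List.Vector Bool n → wordBall X n := fun l =>
      ⟨(l.1.map fun x => cond x a b).prod, l.1.map fun x => cond x a b, by simp [l.2], by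
        intro x hx
        obtain ⟨y, _, rfl⟩ := List.mem_map.1 hx
        cases y <;> simp [X], rfl⟩
    have hφ : Function.Injective φ := fun l l' hll =>
      Subtype.ext (hab l.1 l'.1 (l.2.trans l'.2.symm) (congrArg Subtype.val hll))
    simpa [growthFn] using Nat.card_le_card_of_injective φ hφ
  refine lt_of_lt_of_le one_lt_two (le_ciInf fun n => ?_)
  have hn : (0 : ℝ) < (n : ℝ) + 1 := by positivity
  calc (2 : ℝ) = ((2 : ℝ) ^ (n + 1)) ^ ((1 : ℝ) / (n + 1)) := by
        rw [← Real.rpow_natCast, ← Real.rpow_mul (by norm_num)]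
        push_cast
        rw [mul_one_div_cancel hn.ne', Real.rpow_one]
    _ ≤ _ := by
        refine Real.rpow_le_rpow (by positivity) ?_ (by positivity)
        exact_mod_cast hcard (n + 1)

/-- If `s` acts by conjugation on an abelian normal subgroup with a complex eigenfunctional of
small eigenvalue, then `s` and a translate of `s` form a free pair. -/
theorem hasFreePair_of_eigenfunctional {G : Type*} [Group G] (Z : Subgroup G) [Z.Normal]
    (ℓ : Z →* Multiplicative ℂ) (s : G) (μ : ℂ) (hμ0 : μ ≠ 0) (hμ : ‖μ‖ < 1 / 2)
    (hℓ : ∀ z, (ℓ (MulAut.conjNormal s z)).toAdd = μ * (ℓ z).toAdd) (z : Z) (hz : ℓ z ≠ 1) :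
    HasFreePair G := by
  have hc : (ℓ z).toAdd ≠ 0 := hz
  set c := (ℓ z).toAdd with hc_def
  let F : List Bool → ℂ := fun l => l.foldr (fun x y => cond x c 0 + μ * y) 0
  have hF : ∀ l l' : List Bool, l.length = l'.length → ‖F l - F l'‖ ≤ 2 * ‖c‖ := by
    intro l
    induction l with
    | nil =>
      intro l' hl
      obtain rfl : l' = [] := List.length_eq_zero_iff.1 hl.symm
      simp
    | cons x l ih =>
      rintro (_ | ⟨y, l'⟩) hl
      · simp at hl
      have h1 : ‖(cond x c 0 - cond y c 0 : ℂ)‖ ≤ ‖c‖ := by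
        cases x <;> cases y <;> simp
      have h2 := ih l' (by simpa using hl)
      calc ‖F (x :: l) - F (y :: l')‖ = ‖(cond x c 0 - cond y c 0) + μ * (F l - F l')‖ := by
            simp only [F, List.foldr_cons]; congr 1; ring
        _ ≤ ‖(cond x c 0 - cond y c 0 : ℂ)‖ + ‖μ‖ * ‖F l - F l'‖ := by
            rw [← norm_mul]; exact norm_add_le _ _
        _ ≤ ‖c‖ + (1 / 2) * (2 * ‖c‖) := by gcongr
        _ = 2 * ‖c‖ := by ring
  have hFinj : ∀ l l' : List Bool, l.length = l'.length → F l = F l' → l = l' := by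
    intro l
    induction l with
    | nil => exact fun l' hl _ => (List.length_eq_zero_iff.1 hl.symm).symm
    | cons x l ih =>
      rintro (_ | ⟨y, l'⟩) hl h
      · simp at hl
      have hl' : l.length = l'.length := by simpa using hl
      have h' : (cond x c 0 - cond y c 0 : ℂ) = μ * (F l' - F l) := by
        simp only [F, List.foldr_cons] at h ⊢
        linear_combination h
      have hsmall : ‖μ * (F l' - F l)‖ < ‖c‖ := by
        have hcpos : 0 < ‖c‖ := norm_pos_iff.2 hc
        rw [norm_mul]
        calc ‖μ‖ * ‖F l' - F l‖ ≤ ‖μ‖ * (2 * ‖c‖) := by gcongr; exact hF _ _ hl'.symm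
          _ < (1 / 2) * (2 * ‖c‖) := by gcongr
          _ = ‖c‖ := by ring
      rw [← h'] at hsmall
      have hxy : x = y := by
        cases x <;> cases y <;> simp at hsmall ⊢
      subst hxy
      rw [sub_self, eq_comm, mul_eq_zero, sub_eq_zero] at h'
      rw [ih l' hl' (h'.resolve_left hμ0).symm]
  have hprod : ∀ l : List Bool, ∃ w : Z, (ℓ w).toAdd = F l ∧
      (l.map fun x => cond x ((z : G) * s) s).prod = w * s ^ l.length := by
    intro l
    induction l with
    | nil => exact ⟨1, by simp [F], by simp⟩
    | cons x l ih =>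
      obtain ⟨w, hw, hw'⟩ := ih
      refine ⟨cond x z 1 * MulAut.conjNormal s w, ?_, ?_⟩
      · rw [map_mul, toAdd_mul, hℓ, hw]
        cases x <;> simp [F, hc_def]
      · rw [List.map_cons, List.prod_cons, hw', List.length_cons, pow_succ']
        cases x <;> simp [MulAut.conjNormal_apply, mul_assoc]
  refine ⟨z * s, s, fun l l' hl h => hFinj l l' hl ?_⟩
  obtain ⟨w, hw, hwl⟩ := hprod l
  obtain ⟨w', hw', hwl'⟩ := hprod l'
  rw [hwl, hwl', hl, mul_left_inj] at h
  rw [← hw, ← hw', Subtype.ext h]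

theorem pow_sub_one_pow_dvd_pow_mul_sub_one_pow {R : Type*} [Ring R] (x : R) (m k d : ℕ) :
    (x ^ m - 1) ^ d ∣ (x ^ (m * k) - 1) ^ d := by
  have h : Commute (x ^ m - 1) (∑ i ∈ Finset.range k, (x ^ m) ^ i) :=
    Commute.sum_right _ _ _ fun i _ =>
      Commute.sub_left (Commute.self_pow _ _) (Commute.one_left _)
  rw [pow_mul, ← mul_geom_sum (x ^ m), h.mul_pow]
  exact dvd_mul_right _ _

theorem LinearMap.exists_eigenfunctional_of_isRoot_charpoly {A : Type*} [AddCommGroup A]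
    [Module.Finite ℤ A] [Module.Free ℤ A] (φ : A →ₗ[ℤ] A) {r : ℂ}
    (hr : (φ.charpoly.map (Int.castRingHom ℂ)).IsRoot r) :
    ∃ ℓ : A →ₗ[ℤ] ℂ, ℓ ≠ 0 ∧ ∀ a, ℓ (φ a) = r * ℓ a := by
  classical
  let b := Module.Free.chooseBasis ℤ A
  let M := LinearMap.toMatrix b b φ
  have hM : ((Matrix.scalar _ r - M.map (Int.castRingHom ℂ)).det) = 0 := by
    rw [← LinearMap.charpoly_toMatrix φ b, ← Matrix.charpoly_map, Polynomial.IsRoot.def,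
      Matrix.eval_charpoly] at hr
    exact hr
  obtain ⟨v, hv0, hv⟩ := Matrix.exists_vecMul_eq_zero_iff.2 hM
  refine ⟨b.constr ℤ v, fun h => hv0 (funext fun i => ?_), fun a => ?_⟩
  · rw [← b.constr_basis ℤ v i, h]
    rfl
  · suffices h : (b.constr ℤ v).comp φ = (LinearMap.mulLeft ℤ r).comp (b.constr ℤ v) from
      LinearMap.congr_fun h a
    refine b.ext fun j => ?_
    have hj := congrFun hv j
    simp only [Matrix.vecMul_sub, Matrix.scalar_apply, Pi.sub_apply, Matrix.vecMul_diagonal,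
      Pi.zero_apply, sub_eq_zero] at hj
    rw [LinearMap.comp_apply, LinearMap.comp_apply, LinearMap.mulLeft_apply, b.constr_basis,
      mul_comm, hj, ← b.sum_repr (φ (b j)), map_sum]
    refine Finset.sum_congr rfl fun i _ => ?_
    simp [M, LinearMap.toMatrix_apply, mul_comm]

theorem LinearMap.pow_sub_one_pow_eq_zero {A : Type*} [AddCommGroup A]
    [Module.Finite ℤ A] [Module.Free ℤ A] (φ : Module.End ℤ A) (m : ℕ)
    (h : ∀ r : ℂ, (φ.charpoly.map (Int.castRingHom ℂ)).IsRoot r → r ^ m = 1) :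
    ∃ d : ℕ, (φ ^ m - 1) ^ d = 0 := by
  set p := φ.charpoly
  have hp : (p.map (Int.castRingHom ℂ)).Monic := φ.charpoly_monic.map _
  let s := (p.map (Int.castRingHom ℂ)).roots
  refine ⟨s.card, ?_⟩
  have hdvd : p.map (Int.castRingHom ℂ) ∣
      ((Polynomial.X ^ m - 1) ^ s.card : Polynomial ℤ).map (Int.castRingHom ℂ) := by
    rw [(IsAlgClosed.splits (p.map (Int.castRingHom ℂ))).eq_prod_roots_of_monic hp]
    simp only [Polynomial.map_pow, Polynomial.map_sub, Polynomial.map_X, Polynomial.map_one]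
    rw [← Multiset.prod_replicate, ← Multiset.map_const']
    refine Multiset.prod_dvd_prod_of_dvd _ _ fun r hr => ?_
    rw [Polynomial.dvd_iff_isRoot]
    simp [h r (Polynomial.isRoot_of_mem_roots hr)]
  obtain ⟨q, hq⟩ := (Polynomial.map_dvd_map _ (Int.castRingHom ℂ).injective_int
    φ.charpoly_monic).1 hdvd
  have := congrArg (Polynomial.aeval φ) hq
  rw [map_mul, φ.aeval_self_charpoly, zero_mul] at this
  simpa using this

/-- An automorphism of a finitely generated abelian group either has a complex eigenfunctional with
an eigenvalue of norm greater than one, or has a unipotent power. -/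
theorem LinearEquiv.exists_eigenfunctional_or_unipotent {A : Type*} [AddCommGroup A]
    [Module.Finite ℤ A] (φ : A ≃ₗ[ℤ] A) :
    (∃ (ℓ : A →ₗ[ℤ] ℂ) (r : ℂ), ℓ ≠ 0 ∧ 1 < ‖r‖ ∧ ∀ a, ℓ (φ a) = r * ℓ a) ∨
      ∃ m d : ℕ, 0 < m ∧ ((φ : Module.End ℤ A) ^ m - 1) ^ d = 0 := by
  let T := Submodule.torsion ℤ A
  let f : Module.End ℤ A := φ
  have hT : T ≤ T.comap f := by
    rintro x ⟨a, ha⟩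
    exact ⟨a, by
      rw [Submonoid.smul_def] at ha ⊢
      rw [← LinearMap.map_smul f, ha, map_zero]⟩
  let φ' : Module.End ℤ (A ⧸ T) := T.mapQ T f hT
  have hφ' : ∀ a, φ' (T.mkQ a) = T.mkQ (f a) := fun a => rfl
  have : Module.Free ℤ (A ⧸ T) := inferInstance
  have hroot : ∀ r : ℂ, (φ'.charpoly.map (Int.castRingHom ℂ)).IsRoot r →
      ∃ ℓ : A →ₗ[ℤ] ℂ, ℓ ≠ 0 ∧ ∀ a, ℓ (φ a) = r * ℓ a := by
    intro r hr
    obtain ⟨ℓ, hℓ, h⟩ := φ'.exists_eigenfunctional_of_isRoot_charpoly hr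
    refine ⟨ℓ.comp T.mkQ, fun h0 => hℓ ?_, fun a => h (T.mkQ a)⟩
    exact (LinearMap.cancel_right T.mkQ_surjective).1 (h0.trans (LinearMap.zero_comp _).symm)
  by_cases hbig : ∃ r : ℂ, (φ'.charpoly.map (Int.castRingHom ℂ)).IsRoot r ∧ 1 < ‖r‖
  · obtain ⟨r, hr, hr1⟩ := hbig
    obtain ⟨ℓ, hℓ, h⟩ := hroot r hr
    exact Or.inl ⟨ℓ, r, hℓ, hr1, h⟩
  right
  push Not at hbig
  have hmonic : (φ'.charpoly.map (Int.castRingHom ℂ)).Monic := φ'.charpoly_monic.map _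
  have hmahler : (φ'.charpoly.map (Int.castRingHom ℂ)).mahlerMeasure = 1 := by
    rw [Polynomial.mahlerMeasure_eq_leadingCoeff_mul_prod_roots, hmonic.leadingCoeff, norm_one,
      one_mul]
    refine Multiset.prod_eq_one fun x hx => ?_
    obtain ⟨r, hr, rfl⟩ := Multiset.mem_map.1 hx
    exact max_eq_left (hbig r (Polynomial.isRoot_of_mem_roots hr))
  have hunity : ∀ r : ℂ, (φ'.charpoly.map (Int.castRingHom ℂ)).IsRoot r →
      ∃ n, 0 < n ∧ r ^ n = 1 := by
    intro r hr
    refine Polynomial.pow_eq_one_of_mahlerMeasure_eq_one hmahler ?_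
      ((Polynomial.mem_roots hmonic.ne_zero).2 hr)
    rintro rfl
    obtain ⟨ℓ, hℓ, h⟩ := hroot 0 hr
    refine hℓ (LinearMap.ext fun a => ?_)
    simpa using h (φ.symm a)
  choose! n hn0 hn using hunity
  classical
  let S := (φ'.charpoly.map (Int.castRingHom ℂ)).roots.toFinset
  have hS : ∀ r ∈ S, (φ'.charpoly.map (Int.castRingHom ℂ)).IsRoot r := fun r hr =>
    Polynomial.isRoot_of_mem_roots (Multiset.mem_toFinset.1 hr)
  let m := ∏ r ∈ S, n r
  have hm : 0 < m := Finset.prod_pos fun r hr => hn0 r (hS r hr)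
  obtain ⟨d, hd⟩ := LinearMap.pow_sub_one_pow_eq_zero φ' m fun r hr => by
    have hrS : r ∈ S :=
      Multiset.mem_toFinset.2 ((Polynomial.mem_roots hmonic.ne_zero).2 hr)
    obtain ⟨k, hk⟩ := Finset.dvd_prod_of_mem n hrS
    change r ^ (∏ r ∈ S, n r) = 1
    rw [hk, pow_mul, hn r hr, one_pow]
  have hpow : ∀ k a, (φ' ^ k) (T.mkQ a) = T.mkQ ((f ^ k) a) := by
    intro k
    induction k with
    | zero => exact fun a => rfl
    | succ k ih =>
      intro a
      rw [pow_succ, pow_succ, Module.End.mul_apply, Module.End.mul_apply, hφ', ih]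
  have hpow' : ∀ (k : ℕ) (a : A), ((φ' ^ m - 1) ^ k : Module.End ℤ (A ⧸ T)) (T.mkQ a) =
      T.mkQ (((f ^ m - 1) ^ k : Module.End ℤ A) a) := by
    intro k
    induction k with
    | zero => exact fun a => rfl
    | succ k ih =>
      intro a
      rw [pow_succ, pow_succ, Module.End.mul_apply, Module.End.mul_apply, ← ih, LinearMap.sub_apply,
        LinearMap.sub_apply, hpow, map_sub T.mkQ]
      rfl
  have hmemT : ∀ a, ((f ^ m - 1) ^ d : Module.End ℤ A) a ∈ T := by
    intro a
    rw [← Submodule.ker_mkQ T, LinearMap.mem_ker, ← hpow', hd, LinearMap.zero_apply]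
  have : Finite T := Module.finite_of_fg_torsion _ (Submodule.torsion_isTorsion)
  obtain ⟨k, hk, hkT⟩ : ∃ k, 0 < k ∧ ∀ x ∈ T, (f ^ k) x = x := by
    let g : T → T := fun x => ⟨f x, hT x.2⟩
    have hg : Function.Injective g := fun x y hxy =>
      Subtype.ext (φ.injective (congrArg Subtype.val hxy))
    let e : Equiv.Perm T := Equiv.ofBijective g (Finite.injective_iff_bijective.1 hg)
    have he : ∀ (j : ℕ) (x : T), ((e ^ j) x : A) = (f ^ j) x := by
      intro j
      induction j with
      | zero => exact fun x => rfl
      | succ j ih =>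
        intro x
        rw [pow_succ, pow_succ, Equiv.Perm.mul_apply, Module.End.mul_apply, ih]
        rfl
    refine ⟨orderOf e, orderOf_pos e, fun x hx => ?_⟩
    rw [← he _ ⟨x, hx⟩, pow_orderOf_eq_one]
    rfl
  have hkmT : ∀ x ∈ T, (f ^ (m * k)) x = x := by
    intro x hx
    rw [mul_comm, pow_mul, Module.End.pow_apply]
    exact Function.iterate_fixed (hkT x hx) m
  refine ⟨m * k, d + 1, Nat.mul_pos hm hk, LinearMap.ext fun a => ?_⟩
  obtain ⟨c, hc⟩ := pow_sub_one_pow_dvd_pow_mul_sub_one_pow f m k d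
  change ((f ^ (m * k) - 1) ^ (d + 1) : Module.End ℤ A) a = 0
  rw [pow_succ', Module.End.mul_apply, hc, Module.End.mul_apply, LinearMap.sub_apply,
    hkmT _ (hmemT _), Module.End.one_apply, sub_self]

theorem Group.isNilpotent_of_ker_le_upperCentralSeries {L H : Type*} [Group L] [Group H]
    [hH : Group.IsNilpotent H] (f : L →* H) (d : ℕ) (h : f.ker ≤ Subgroup.upperCentralSeries L d) :
    Group.IsNilpotent L := by
  obtain ⟨c, hc⟩ := Subgroup.nilpotent_iff_lowerCentralSeries.1 hH
  have hcL : (⊤ : Subgroup L).lowerCentralSeries c ≤ f.ker := by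
    rw [← MonoidHom.comap_bot, ← Subgroup.map_le_iff_le_comap, ← hc]
    exact (Subgroup.map_lowerCentralSeries ..).trans_le (Subgroup.lowerCentralSeries_mono _ le_top)
  have key : ∀ j, j ≤ d → (⊤ : Subgroup L).lowerCentralSeries (c + j) ≤
      Subgroup.upperCentralSeries L (d - j) := by
    intro j
    induction j with
    | zero => exact fun _ => hcL.trans h
    | succ j ih =>
      intro hj
      rw [← add_assoc, Subgroup.lowerCentralSeries_succ, Subgroup.commutator_le]
      intro x hx y _
      have := ih (by omega) hx
      rw [show d - j = d - (j + 1) + 1 by omega] at this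
      exact Subgroup.mem_upperCentralSeries_succ_iff.1 this y
  refine Subgroup.nilpotent_iff_lowerCentralSeries.2 ⟨c + d, eq_bot_iff.2 ?_⟩
  simpa using key d le_rfl

/-- If `P` is a nilpotent normal subgroup all of whose subgroups are finitely generated, and the
ambient group has no free pair, then some proper power of any element generates together with `P`
a nilpotent subgroup. -/
theorem exists_isNilpotent_sup_zpowers (n : ℕ) : ∀ {G : Type u} [Group G], ¬ HasFreePair G →
    ∀ (P : Subgroup G) [P.Normal], (∀ K ≤ P, K.FG) → P.lowerCentralSeries n = ⊥ →
    ∀ t : G, ∃ m, 0 < m ∧ Group.IsNilpotent (P ⊔ Subgroup.zpowers (t ^ m) : Subgroup G) := by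
  induction n with
  | zero =>
    intro G _ _ P _ _ hP t
    refine ⟨1, one_pos, ?_⟩
    rw [Subgroup.lowerCentralSeries_zero] at hP
    rw [hP, bot_sup_eq]
    let := IsCyclic.commGroup (α := Subgroup.zpowers (t ^ 1))
    exact CommGroup.isNilpotent
  | succ n ih =>
    intro G _ hG P _ hfg hP t
    let Z : Subgroup G := P.lowerCentralSeries n
    have hZP : Z ≤ P := P.lowerCentralSeries_le_self n
    have hcomm : ∀ z ∈ Z, ∀ p ∈ P, z * p = p * z := by
      intro z hz p hp
      rw [Subgroup.lowerCentralSeries_succ, Subgroup.commutator_eq_bot_iff_le_centralizer] at hP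
      exact (Subgroup.mem_centralizer_iff.1 (hP hz) p hp).symm
    let Q : G →* G ⧸ Z := QuotientGroup.mk' Z
    have hQ : Function.Surjective Q := QuotientGroup.mk'_surjective Z
    have hPQ : (P.map Q).Normal := Subgroup.Normal.map inferInstance Q hQ
    obtain ⟨m₁, hm₁, hL₁⟩ := ih (G := G ⧸ Z) (fun h => hG (h.of_surjective Q hQ)) (P.map Q)
      (fun K hK => by
        have : K = (K.comap Q ⊓ P).map Q := by
          refine le_antisymm (fun x hx => ?_) (Subgroup.map_le_iff_le_comap.2 inf_le_left)
          obtain ⟨p, hp, rfl⟩ := hK hx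
          exact ⟨p, ⟨hx, hp⟩, rfl⟩
        rw [this]
        exact (hfg _ inf_le_right).map_hom Q)
      (by
        rw [← Subgroup.map_lowerCentralSeries, Subgroup.map_eq_bot_iff, QuotientGroup.ker_mk'])
      (Q t)
    let : CommGroup Z :=
      { (inferInstance : Group Z) with
        mul_comm := fun x y => Subtype.ext (hcomm x x.2 y (hZP y.2)) }
    have : Module.Finite ℤ (Additive Z) := by
      rw [Module.Finite.iff_addGroup_fg, ← GroupFG.iff_add_fg]
      exact (Group.fg_iff_subgroup_fg Z).2 (hfg Z hZP)
    let φ : Additive Z ≃ₗ[ℤ] Additive Z :=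
      (MulEquiv.toAdditive (MulAut.conjNormal t : Z ≃* Z)).toIntLinearEquiv
    have hφ : ∀ (k : ℕ) (z : Z), ((φ : Module.End ℤ (Additive Z)) ^ k) (Additive.ofMul z) =
        Additive.ofMul (MulAut.conjNormal (t ^ k) z) := by
      intro k
      induction k with
      | zero => exact fun z => by simp
      | succ k ih =>
        intro z
        rw [pow_succ, pow_succ, Module.End.mul_apply, map_mul, MulAut.mul_apply, ← ih]
        rfl
    rcases φ.exists_eigenfunctional_or_unipotent with ⟨ℓ, r, hℓ, hr, h⟩ | ⟨m₂, d, hm₂, hd⟩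
    · exfalso
      have hr0 : r ≠ 0 := norm_pos_iff.1 (one_pos.trans hr)
      obtain ⟨k, hk⟩ := exists_pow_lt_of_lt_one (show (0 : ℝ) < 1 / 2 by norm_num)
        (inv_lt_one_of_one_lt₀ hr)
      have hpow : ∀ (k : ℕ) (z : Z), ℓ (Additive.ofMul (MulAut.conjNormal (t ^ k) z)) =
          r ^ k * ℓ (Additive.ofMul z) := by
        intro k
        induction k with
        | zero => exact fun z => by simp
        | succ k ih =>
          intro z
          rw [pow_succ', map_mul, MulAut.mul_apply, pow_succ', mul_assoc, ← ih, ← h]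
          rfl
      obtain ⟨z, hz⟩ : ∃ z : Z, ℓ (Additive.ofMul z) ≠ 0 := by
        by_contra! hz
        exact hℓ (LinearMap.ext fun a => hz a.toMul)
      refine hG (hasFreePair_of_eigenfunctional Z
        (AddMonoidHom.toMultiplicativeRight ℓ.toAddMonoidHom) (t ^ k)⁻¹ (r ^ k)⁻¹ (by positivity) ?_ (fun z => ?_) z hz)
      · rwa [norm_inv, norm_pow, ← inv_pow]
      · have := hpow k (MulAut.conjNormal (t ^ k)⁻¹ z)
        rw [← MulAut.mul_apply, ← map_mul, mul_inv_cancel, map_one, MulAut.one_apply] at this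
        change ℓ (Additive.ofMul _) = _ * ℓ (Additive.ofMul z)
        rw [this, inv_mul_cancel_left₀ (pow_ne_zero _ hr0)]
    · let m := m₂ * m₁
      refine ⟨m, Nat.mul_pos hm₂ hm₁, ?_⟩
      let L : Subgroup G := P ⊔ Subgroup.zpowers (t ^ m)
      have hPL : P ≤ L := le_sup_left
      have htL : t ^ m ∈ L := Subgroup.mem_sup_right (Subgroup.mem_zpowers _)
      have hucs : ∀ (j : ℕ) (z : Z),
          (((φ : Module.End ℤ (Additive Z)) ^ m - 1) ^ j) (Additive.ofMul z) = 0 →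
          (⟨z, hPL (hZP z.2)⟩ : L) ∈ Subgroup.upperCentralSeries L j := by
        intro j
        induction j with
        | zero =>
          intro z hz
          obtain rfl : z = 1 := hz
          exact one_mem _
        | succ j ih =>
          intro z hz
          rw [pow_succ, Module.End.mul_apply, LinearMap.sub_apply, hφ] at hz
          have hw := ih (MulAut.conjNormal (t ^ m) z * z⁻¹) (by
            rwa [ofMul_mul, ofMul_inv, ← sub_eq_add_neg])
          let q := QuotientGroup.mk' (Subgroup.upperCentralSeries L j)
          let z' : L := ⟨z, hPL (hZP z.2)⟩
          let D : Subgroup L := (Subgroup.centralizer {q z'}).comap q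
          have hDP : ∀ p (hp : p ∈ P), (⟨p, hPL hp⟩ : L) ∈ D := by
            intro p hp
            refine Subgroup.mem_centralizer_singleton_iff.2 ?_
            rw [← map_mul, ← map_mul]
            exact congrArg q (Subtype.ext (hcomm z z.2 p hp).symm)
          have hDt : (⟨t ^ m, htL⟩ : L) ∈ D := by
            refine Subgroup.mem_centralizer_singleton_iff.2 ?_
            rw [← mul_inv_eq_one, ← map_mul, ← map_mul, ← map_inv, ← map_mul]
            refine (QuotientGroup.eq_one_iff _).2 ?_
            convert hw using 1
            apply Subtype.ext
            simp [z', mul_assoc, -map_pow]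
          have hD : ∀ y, y ∈ D := by
            rintro ⟨y, hy⟩
            obtain ⟨p, hp, s, ⟨i, rfl⟩, rfl⟩ := Subgroup.mem_sup_of_normal_left.1 hy
            exact D.mul_mem (hDP p hp) (D.zpow_mem hDt i)
          refine Subgroup.mem_upperCentralSeries_succ_iff.2 fun y => ?_
          refine (QuotientGroup.eq_one_iff _).1 ?_
          have := Subgroup.mem_centralizer_singleton_iff.1 (hD y)
          change q (z' * y * z'⁻¹ * y⁻¹) = 1
          rw [map_mul, map_mul, map_mul, map_inv, map_inv, ← this]
          group
      let L₁ : Subgroup (G ⧸ Z) := P.map Q ⊔ Subgroup.zpowers (Q t ^ m₁)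
      have hLL₁ : L ≤ L₁.comap Q := by
        refine sup_le ?_ ?_
        · rw [← Subgroup.map_le_iff_le_comap]
          exact le_sup_left
        · rw [Subgroup.zpowers_le, Subgroup.mem_comap, map_pow]
          change Q t ^ (m₂ * m₁) ∈ L₁
          rw [mul_comm, pow_mul]
          exact Subgroup.pow_mem _ (Subgroup.mem_sup_right (Subgroup.mem_zpowers _)) _
      have : Group.IsNilpotent L₁ := hL₁
      refine Group.isNilpotent_of_ker_le_upperCentralSeries
        ((Q.comp L.subtype).codRestrict L₁ fun x => hLL₁ x.2) d ?_
      rintro ⟨x, hx⟩ hxk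
      have hxZ : x ∈ Z := (QuotientGroup.eq_one_iff x).1 (congrArg Subtype.val hxk)
      refine hucs d ⟨x, hxZ⟩ ?_
      obtain ⟨c, hc⟩ := pow_sub_one_pow_dvd_pow_mul_sub_one_pow
        (φ : Module.End ℤ (Additive Z)) m₂ m₁ d
      rw [hc, hd, zero_mul, LinearMap.zero_apply]

theorem Group.fg_of_fg_ker_of_fg_range {G A : Type*} [Group G] [Group A] (f : G →* A)
    (hk : f.ker.FG) (hr : f.range.FG) : Group.FG G := by
  classical
  obtain ⟨S, hS⟩ := hk
  obtain ⟨T, hT⟩ := hr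
  obtain ⟨T', -, rfl⟩ := Finset.subset_set_image_iff.1 (show (T : Set A) ⊆ f '' Set.univ by
    rw [Set.image_univ, ← MonoidHom.coe_range, ← hT]
    exact Subgroup.subset_closure)
  rw [Finset.coe_image, ← MonoidHom.map_closure] at hT
  refine ⟨⟨S ∪ T', eq_top_iff.2 fun g _ => ?_⟩⟩
  obtain ⟨x, hx, hxg⟩ : f g ∈ (Subgroup.closure (T' : Set G)).map f := hT ▸ ⟨g, rfl⟩
  have hk : x⁻¹ * g ∈ Subgroup.closure (S : Set G) := by
    rw [hS, MonoidHom.mem_ker, map_mul, map_inv, hxg, inv_mul_cancel]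
  rw [Finset.coe_union, Subgroup.closure_union, ← mul_inv_cancel_left x g]
  exact mul_mem (Subgroup.mem_sup_right hx) (Subgroup.mem_sup_left hk)

theorem MonoidHom.exists_forall_map_eq_zpow {G A : Type*} [Group G] [Group A] [IsCyclic A]
    (f : G →* A) : ∃ t : G, ∀ g, ∃ i : ℤ, f g = f t ^ i := by
  obtain ⟨⟨_, t, rfl⟩, ht⟩ := IsCyclic.exists_generator (α := f.range)
  refine ⟨t, fun g => ?_⟩
  obtain ⟨i, hi⟩ := ht ⟨f g, g, rfl⟩
  exact ⟨i, (congrArg Subtype.val hi).symm⟩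

theorem PolyCyclicOrFinite.fg {G : Type u} {inst : Group G} (hG : PolyCyclicOrFinite G) :
    Group.FG G := by
  induction hG with
  | trivial G h => exact ⟨⟨∅, Subsingleton.elim _ _⟩⟩
  | @ext G A _ _ f hA _ ih =>
    refine Group.fg_of_fg_ker_of_fg_range f ((Group.fg_iff_subgroup_fg _).1 ih) ?_
    rcases hA with hA | hA
    · obtain ⟨t, ht⟩ := f.exists_forall_map_eq_zpow
      refine ⟨{f t}, ?_⟩
      rw [Finset.coe_singleton, ← Subgroup.zpowers_eq_closure]
      refine le_antisymm (Subgroup.zpowers_le.2 ⟨t, rfl⟩) ?_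
      rintro _ ⟨g, rfl⟩
      obtain ⟨i, hi⟩ := ht g
      exact ⟨i, hi.symm⟩
    · exact (Group.fg_iff_subgroup_fg _).1 inferInstance
  | directed hloc => exact hloc.elim

theorem PolyCyclicOrFinite.subgroup_fg {G : Type u} [Group G] (hG : PolyCyclicOrFinite G)
    (K : Subgroup G) : K.FG :=
  (Group.fg_iff_subgroup_fg K).1
    (PolyCyclicOrFinite.fg (hG.of_injective K.subtype K.subtype_injective))

theorem finiteIndex_sup_zpowers {G A : Type*} [Group G] [Group A] (f : G →* A) (t : G)
    (ht : ∀ g, ∃ i : ℤ, f g = f t ^ i) (P : Subgroup G) [P.Normal]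
    (hP : (P.subgroupOf f.ker).FiniteIndex) (m : ℕ) (hm : 0 < m) :
    (P ⊔ Subgroup.zpowers (t ^ m)).FiniteIndex := by
  let L := P ⊔ Subgroup.zpowers (t ^ m)
  have hsurj : Function.Surjective fun x : (f.ker ⧸ P.subgroupOf f.ker) × Fin m =>
      (QuotientGroup.mk ((x.1.out : G) * t ^ (x.2 : ℕ)) : G ⧸ L) := by
    intro y
    obtain ⟨g, rfl⟩ := QuotientGroup.mk_surjective y
    obtain ⟨i, hi⟩ := ht g
    let n : f.ker := ⟨g * (t ^ i)⁻¹, by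
      rw [MonoidHom.mem_ker, map_mul, map_inv, map_zpow, hi, mul_inv_cancel]⟩
    have hm' : (m : ℤ) ≠ 0 := by exact_mod_cast hm.ne'
    have hr : (((i % m).toNat : ℕ) : ℤ) = i % m := Int.toNat_of_nonneg (Int.emod_nonneg _ hm')
    have hlt : (i % m).toNat < m := by
      have := Int.emod_lt_of_pos i (show (0 : ℤ) < m by exact_mod_cast hm)
      omega
    refine ⟨⟨QuotientGroup.mk n, ⟨(i % m).toNat, hlt⟩⟩, ?_⟩
    obtain ⟨p, hp⟩ := QuotientGroup.mk_out_eq_mul (P.subgroupOf f.ker) n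
    have hpP : (p : G) ∈ P := p.2
    refine QuotientGroup.eq.2 ?_
    simp only [hp]
    have hg : g = n * t ^ (i % m) * (t ^ m) ^ (i / m) := by
      rw [← zpow_natCast t m, ← zpow_mul, mul_assoc, ← zpow_add, Int.emod_add_mul_ediv]
      exact (inv_mul_cancel_right g (t ^ i)).symm
    have : ((n * p : f.ker) * t ^ (i % m).toNat : G)⁻¹ * g =
        ((t ^ (i % m))⁻¹ * (p : G)⁻¹ * ((t ^ (i % m))⁻¹)⁻¹) * (t ^ m) ^ (i / m) := by
      conv_lhs => rw [hg, ← zpow_natCast t (i % m).toNat, hr, Subgroup.coe_mul]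
      group
    rw [this]
    exact Subgroup.mul_mem_sup (Subgroup.Normal.conj_mem inferInstance _ (inv_mem hpP) _)
      (zpow_mem (Subgroup.mem_zpowers _) _)
  have := Finite.of_surjective _ hsurj
  exact Subgroup.finiteIndex_of_finite_quotient

theorem Subgroup.exists_characteristic_finiteIndex_le {N : Type*} [Group N] [Group.FG N]
    (K : Subgroup N) [K.FiniteIndex] :
    ∃ P : Subgroup N, P.Characteristic ∧ P.FiniteIndex ∧ P ≤ K :=
  ⟨commonKer N (N ⧸ K.normalCore), inferInstance, inferInstance, fun x hx =>
    K.normalCore_le ((QuotientGroup.eq_one_iff x).1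
      (mem_commonKer.1 hx (QuotientGroup.mk' K.normalCore)))⟩

/-- A poly-(cyclic or finite) group has a finite-index subgroup in a class `Φ`, provided that `Φ`
is closed under subgroups and under extension by some power of any element. -/
theorem PolyCyclicOrFinite.exists_finiteIndex {Ψ Φ : (G : Type u) → Group G → Prop}
    (hΨ : ∀ {G H : Type u} [instG : Group G] [instH : Group H] (f : H →* G),
      Function.Injective f → Ψ G instG → Ψ H instH)
    (hΦ : ∀ {G H : Type u} [instG : Group G] [instH : Group H] (f : H →* G),
      Function.Injective f → Φ G instG → Φ H instH)
    (htriv : ∀ (G : Type u) [instG : Group G], Subsingleton G → Φ G instG)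
    (hext : ∀ {G : Type u} [instG : Group G], PolyCyclicOrFinite G → Ψ G instG →
      ∀ (P : Subgroup G) [P.Normal], Φ P inferInstance →
      ∀ t : G, ∃ m, 0 < m ∧ Φ (P ⊔ Subgroup.zpowers (t ^ m) : Subgroup G) inferInstance)
    {G : Type u} {inst : Group G} (hG : PolyCyclicOrFinite G) (hGΨ : Ψ G inst) :
    ∃ H : Subgroup G, H.FiniteIndex ∧ Φ H inferInstance := by
  induction hG with
  | trivial G h => exact ⟨⊤, inferInstance, htriv _ inferInstance⟩
  | @ext G A _ _ f hA hker ih =>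
    obtain ⟨K, hK, hKΦ⟩ := ih (hΨ f.ker.subtype f.ker.subtype_injective hGΨ)
    have hmap : ∀ P ≤ K, Φ (P.map f.ker.subtype) inferInstance := fun P hP =>
      hΦ ((Subgroup.inclusion hP).comp
        (P.equivMapOfInjective _ f.ker.subtype_injective).symm.toMonoidHom)
        ((Subgroup.inclusion_injective hP).comp (MulEquiv.injective _)) hKΦ
    rcases hA with hA' | hA'
    · have := PolyCyclicOrFinite.fg hker
      obtain ⟨P, hPchar, hPfin, hPK⟩ := K.exists_characteristic_finiteIndex_le
      obtain ⟨t, ht⟩ := f.exists_forall_map_eq_zpow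
      obtain ⟨m, hm, hmΦ⟩ := hext (.ext f (Or.inl hA') hker) hGΨ (P.map f.ker.subtype)
        (hmap P hPK) t
      refine ⟨_, finiteIndex_sup_zpowers f t ht _ ?_ m hm, hmΦ⟩
      rwa [Subgroup.subgroupOf, Subgroup.comap_map_eq_self_of_injective f.ker.subtype_injective]
    · refine ⟨K.map f.ker.subtype, ⟨?_⟩, hmap K le_rfl⟩
      rw [Subgroup.index_map_subtype]
      exact mul_ne_zero Subgroup.FiniteIndex.index_ne_zero Subgroup.FiniteIndex.index_ne_zero
  | directed hloc => exact hloc.elim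

theorem PolyCyclicOrFinite.isVirtuallyNilpotent {G : Type u} [Group G]
    (hG : PolyCyclicOrFinite G) (h : ¬ HasFreePair G) : IsVirtuallyNilpotent G := by
  refine PolyCyclicOrFinite.exists_finiteIndex (Ψ := fun G _ => ¬ HasFreePair G)
    (Φ := fun G _ => Group.IsNilpotent G) ?_ ?_ ?_ ?_ hG h
  · exact fun f hf hG hH => hG (hH.map f hf)
  · intro G H _ _ f hf hG
    exact (Group.isNilpotent_congr (f.ofInjective hf)).2 (Subgroup.isNilpotent f.range)
  · intro G _ _
    infer_instance
  · intro G _ hG hGΨ P _ hP t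
    obtain ⟨n, hn⟩ := (Subgroup.isNilpotent_iff_lowerCentralSeries P).1 hP
    exact exists_isNilpotent_sup_zpowers n hGΨ P (fun K _ => hG.subgroup_fg K) hn t

theorem GeneratedBy.isPolycyclic {G : Type u} {inst : Group G}
    (hG : GeneratedBy (fun A _ => IsCyclic A) False G inst) : IsPolycyclic G := by
  induction hG with
  | trivial G h => exact ⟨0, fun _ => ⊥, rfl, Subsingleton.elim _ _, fun i => i.elim0⟩
  | @ext G A _ _ f hA _ ih =>
    obtain ⟨n, P, h0, hn, hP⟩ := ih
    refine ⟨n + 1, Fin.snoc (α := fun _ => Subgroup G) (fun i => (P i).map f.ker.subtype) ⊤,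
      ?_, Fin.snoc_last _ _, fun i => ?_⟩
    · rw [← Fin.castSucc_zero, Fin.snoc_castSucc, h0, Subgroup.map_bot]
    · induction i using Fin.lastCases with
      | last =>
        obtain ⟨t, ht⟩ := f.exists_forall_map_eq_zpow
        rw [Fin.succ_last, Fin.snoc_last, Fin.snoc_castSucc, hn, ← MonoidHom.range_eq_map,
          Subgroup.range_subtype]
        refine ⟨le_top, fun x _ h hh => f.normal_ker.conj_mem h hh x, t, Subgroup.mem_top t,
          fun x _ => ?_⟩
        obtain ⟨i, hi⟩ := ht x
        refine ⟨i, ?_⟩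
        rw [MonoidHom.mem_ker, map_mul, map_inv, map_zpow, hi, inv_mul_cancel]
      | cast i =>
        obtain ⟨hle, hnorm, g, hg, hgen⟩ := hP i
        rw [← Fin.castSucc_succ, Fin.snoc_castSucc, Fin.snoc_castSucc]
        refine ⟨Subgroup.map_mono hle, ?_, g, ⟨g, hg, rfl⟩, ?_⟩
        · rintro _ ⟨x, hx, rfl⟩ _ ⟨y, hy, rfl⟩
          exact ⟨_, hnorm x hx y hy, rfl⟩
        · rintro _ ⟨x, hx, rfl⟩
          obtain ⟨k, hk⟩ := hgen x hx
          exact ⟨k, _, hk, rfl⟩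
  | directed hloc => exact hloc.elim

theorem isCyclic_sup_zpowers_quotient {G : Type*} [Group G] (P : Subgroup G) [P.Normal] (t : G) :
    IsCyclic ((P ⊔ Subgroup.zpowers t : Subgroup G) ⧸ P.subgroupOf (P ⊔ Subgroup.zpowers t)) := by
  refine ⟨QuotientGroup.mk ⟨t, Subgroup.mem_sup_right (Subgroup.mem_zpowers t)⟩, fun y => ?_⟩
  obtain ⟨⟨y, hy⟩, rfl⟩ := QuotientGroup.mk_surjective y
  obtain ⟨_, ⟨i, rfl⟩, p, hp, rfl⟩ := Subgroup.mem_sup_of_normal_right.1 (sup_comm P _ ▸ hy)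
  refine ⟨i, QuotientGroup.eq.2 ?_⟩
  change (t ^ i)⁻¹ * (t ^ i * p) ∈ P
  rwa [inv_mul_cancel_left]

theorem PolyCyclicOrFinite.isVirtuallyPolycyclic {G : Type u} [Group G]
    (hG : PolyCyclicOrFinite G) : IsVirtuallyPolycyclic G := by
  obtain ⟨H, hH, hHC⟩ := PolyCyclicOrFinite.exists_finiteIndex (Ψ := fun _ _ => True)
    (Φ := GeneratedBy (fun A _ => IsCyclic A) False) (fun _ _ h => h)
    (fun f hf hG => hG.of_injective f hf) (fun G _ h => .trivial G h) (by
      intro G _ _ _ P _ hP t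
      refine ⟨1, one_pos, ?_⟩
      let L : Subgroup G := P ⊔ Subgroup.zpowers (t ^ 1)
      refine .ext (QuotientGroup.mk' (P.subgroupOf L)) (isCyclic_sup_zpowers_quotient P _) ?_
      refine hP.of_injective ((L.subtype.comp (Subgroup.subtype _)).codRestrict P fun x =>
        (QuotientGroup.eq_one_iff x.1).1 x.2) fun x y hxy => ?_
      have hxy' := congrArg Subtype.val hxy
      exact Subtype.ext (Subtype.ext hxy')) hG trivial
  exact ⟨H, hH, hHC.isPolycyclic⟩

/-- **Proposition 3.1 (Osin).** Let `G` be a finitely generated elementary amenable group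
which is not virtually nilpotent. Then there is a normal subgroup `H` of `G` such that
`G/H` is virtually polycyclic and either `G/H` has exponential growth or `H` is not
finitely generated. -/
theorem elementaryAmenable_dichotomy
    {G : Type u} [inst : Group G] (hfg : Group.FG G)
    (hEA : ElementaryAmenable G inst) (hnn : ¬ IsVirtuallyNilpotent G) :
    ∃ (H : Subgroup G) (_ : H.Normal),
      IsVirtuallyPolycyclic (G ⧸ H) ∧
      (HasExponentialGrowth (G ⧸ H) ∨ ¬ H.FG) := by
  have htop : PolyCyclicOrFinite (G ⧸ (⊤ : Subgroup G)) :=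
    .trivial _ QuotientGroup.subsingleton_quotient_top
  rcases hEA.generatedBy.polyCyclicOrFinite_or_exists_not_fg (⊤ : Subgroup G)
    (⊤ : Subgroup G).subtype (Subgroup.subtype_injective _) hfg.out htop with h | ⟨H, hH, hPC, hnfg⟩
  · have e : G ⧸ (⊥ : Subgroup G) ≃* G := QuotientGroup.quotientBot
    have hPC : PolyCyclicOrFinite (G ⧸ (⊥ : Subgroup G)) :=
      h.of_injective e.toMonoidHom e.injective
    have hfree : HasFreePair G := by
      by_contra hG
      exact hnn (PolyCyclicOrFinite.isVirtuallyNilpotent h hG)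
    exact ⟨⊥, inferInstance, PolyCyclicOrFinite.isVirtuallyPolycyclic hPC,
      Or.inl ((hfree.map e.symm.toMonoidHom e.symm.injective).hasExponentialGrowth hPC.fg)⟩
  · exact ⟨H, hH, PolyCyclicOrFinite.isVirtuallyPolycyclic hPC, Or.inr hnfg⟩
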